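/- arXiv:2012.10140 — 2 statements merged into one kernel-verified Lean document; each statement's English description precedes it below -/
import Mathlib

section
/- Consider a finite-horizon discounted MDP skeleton (S, A, T, R, R_max, γ) with horizon D, optimal value functions V*_d, and restricted value functions V̂_d defined from nonempty subsets A'(s,d) ⊆ A as in the standing definitions; write Q̂_d(s,a) = R(s,a) + γ ∫_S V̂_{d+1} dT(s,a). Suppose there is ρ ≥ 0 such that for every s ∈ S and every 0 ≤ d < D the per-node regret satisfies ⨆_{a∈A} Q̂_d(s,a) − ⨆_{a∈A'(s,d)} Q̂_d(s,a) ≤ ρ. Then for every 0 ≤ d ≤ D and every s ∈ S, 0 ≤ V*_d(s) − V̂_d(s) ≤ ρ·(1 − γ^{D−d})/(1 − γ) ≤ ρ/(1 − γ). (This is the deterministic form of the 'VOO bound' step in the VOWSS and VOSS Intermediate Inequalities: per-node action-selection regret ρ accumulates to at most ρ/(1−γ).) -/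
open MeasureTheory

lemma bddAbove_range_of_forall_abs_le {ι : Sort*} {f : ι → ℝ} {C : ℝ}
    (h : ∀ i, |f i| ≤ C) : BddAbove (Set.range f) :=
  ⟨C, by rintro _ ⟨i, rfl⟩; exact (abs_le.1 (h i)).2⟩

lemma abs_ciSup_le_of_forall_abs_le {ι : Sort*} [Nonempty ι] {f : ι → ℝ} {C : ℝ}
    (h : ∀ i, |f i| ≤ C) : |⨆ i, f i| ≤ C := by
  let i : ι := Classical.arbitrary ι
  exact abs_le.2 ⟨(abs_le.1 (h i)).1.trans (le_ciSup (bddAbove_range_of_forall_abs_le h) i),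
    ciSup_le fun j => (abs_le.1 (h j)).2⟩

lemma abs_add_mul_integral_le {S : Type*} [MeasurableSpace S] (μ : Measure S)
    [IsProbabilityMeasure μ] {V : S → ℝ} {C r b γ : ℝ} (hγ : 0 ≤ γ) (hr : |r| ≤ b)
    (hV : ∀ x, |V x| ≤ C) : |r + γ * ∫ x, V x ∂μ| ≤ b + γ * C := by
  have hint : |∫ x, V x ∂μ| ≤ C := by
    simpa using norm_integral_le_of_norm_le_const (μ := μ) (f := V) (C := C)
      (Filter.Eventually.of_forall hV)
  calc |r + γ * ∫ x, V x ∂μ| ≤ |r| + |γ * ∫ x, V x ∂μ| := abs_add_le _ _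
    _ = |r| + γ * |∫ x, V x ∂μ| := by rw [abs_mul, abs_of_nonneg hγ]
    _ ≤ b + γ * C := by gcongr

lemma integrable_of_measurable_of_forall_abs_le {S : Type*} [MeasurableSpace S] (μ : Measure S)
    [IsFiniteMeasure μ] {V : S → ℝ} {C : ℝ} (hm : Measurable V) (hV : ∀ x, |V x| ≤ C) :
    Integrable V μ :=
  Integrable.of_bound hm.aestronglyMeasurable C (Filter.Eventually.of_forall hV)

lemma measurable_integral_of_measurable_measure {S : Type*} [MeasurableSpace S]
    {T : S → Measure S} [∀ s, IsProbabilityMeasure (T s)] (hTm : Measurable T)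
    {V : S → ℝ} (hV : Measurable V) : Measurable fun s => ∫ x, V x ∂(T s) := by
  let κ : ProbabilityTheory.Kernel S S := ⟨T, hTm⟩
  have : ProbabilityTheory.IsMarkovKernel κ := ⟨fun s => inferInstanceAs (IsProbabilityMeasure (T s))⟩
  exact (hV.stronglyMeasurable.integral_kernel (κ := κ)).measurable

/-- "VOO bound" step (deterministic form): if at every node the per-node action-selection regret
of the restricted action sets `A'(s,d)` with respect to `Q̂_d` is at most `ρ`, then
`0 ≤ V*_d(s) − V̂_d(s) ≤ ρ·(1 − γ^(D−d))/(1 − γ) ≤ ρ/(1 − γ)`. -/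
theorem voo_regret_accumulation
    {S : Type*} [MeasurableSpace S]
    {A : Type*} [Countable A] [Nonempty A]
    (T : S → A → Measure S) (hT : ∀ s a, IsProbabilityMeasure (T s a))
    (hTmeas : ∀ a : A, Measurable fun s => T s a)
    (R : S → A → ℝ) (hRmeas : ∀ a : A, Measurable fun s => R s a)
    (Rmax : ℝ) (hRmax : 0 ≤ Rmax) (hR : ∀ s a, |R s a| ≤ Rmax)
    (γ : ℝ) (hγ0 : 0 ≤ γ) (hγ1 : γ < 1)
    (D : ℕ)
    (Vstar : ℕ → S → ℝ)
    (hVstarD : ∀ s, Vstar D s = 0)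
    (hVstar : ∀ d, d < D → ∀ s,
      Vstar d s = ⨆ a : A, (R s a + γ * ∫ x, Vstar (d + 1) x ∂(T s a)))
    (A' : S → ℕ → Set A) (hA' : ∀ s d, (A' s d).Nonempty)
    (Vhat : ℕ → S → ℝ)
    (hVhatMeas : ∀ d, Measurable (Vhat d))
    (hVhatD : ∀ s, Vhat D s = 0)
    (hVhat : ∀ d, d < D → ∀ s,
      Vhat d s = ⨆ a : A' s d, (R s ↑a + γ * ∫ x, Vhat (d + 1) x ∂(T s ↑a)))
    (ρ : ℝ) (hρ : 0 ≤ ρ)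
    (hregret : ∀ s, ∀ d, d < D →
      (⨆ a : A, (R s a + γ * ∫ x, Vhat (d + 1) x ∂(T s a))) -
        (⨆ a : A' s d, (R s ↑a + γ * ∫ x, Vhat (d + 1) x ∂(T s ↑a))) ≤ ρ) :
    ∀ d ≤ D, ∀ s,
      0 ≤ Vstar d s - Vhat d s ∧
      Vstar d s - Vhat d s ≤ ρ * (1 - γ ^ (D - d)) / (1 - γ) ∧
      ρ * (1 - γ ^ (D - d)) / (1 - γ) ≤ ρ / (1 - γ) := by
  have hγ : 0 < 1 - γ := by linarith
  have key : ∀ k d, d + k = D →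
      (Measurable (Vstar d) ∧ (∃ C, ∀ s, |Vstar d s| ≤ C) ∧ ∃ C, ∀ s, |Vhat d s| ≤ C) ∧
      ∀ s, 0 ≤ Vstar d s - Vhat d s ∧ Vstar d s - Vhat d s ≤ ρ * (1 - γ ^ k) / (1 - γ) := by
    intro k
    induction k with
    | zero =>
      intro d hd
      obtain rfl : d = D := by omega
      have h0 : Vstar d = fun _ => 0 := funext hVstarD
      exact ⟨⟨h0 ▸ measurable_const, ⟨0, by simp [hVstarD]⟩, ⟨0, by simp [hVhatD]⟩⟩,
        by simp [hVstarD, hVhatD]⟩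
    | succ k ih =>
      intro d hd
      have hdD : d < D := by omega
      obtain ⟨⟨hm, ⟨C, hC⟩, ⟨C', hC'⟩⟩, hdiff⟩ := ih (d + 1) (by omega)
      have hQ : ∀ s a, |R s a + γ * ∫ x, Vstar (d + 1) x ∂(T s a)| ≤ Rmax + γ * C :=
        fun s a => abs_add_mul_integral_le (T s a) hγ0 (hR s a) hC
      have hQ' : ∀ s a, |R s a + γ * ∫ x, Vhat (d + 1) x ∂(T s a)| ≤ Rmax + γ * C' :=
        fun s a => abs_add_mul_integral_le (T s a) hγ0 (hR s a) hC'
      have hi : ∀ s a, Integrable (Vstar (d + 1)) (T s a) :=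
        fun s a => integrable_of_measurable_of_forall_abs_le _ hm hC
      have hi' : ∀ s a, Integrable (Vhat (d + 1)) (T s a) :=
        fun s a => integrable_of_measurable_of_forall_abs_le _ (hVhatMeas _) hC'
      refine ⟨⟨?_, ⟨Rmax + γ * C, fun s => ?_⟩, ⟨Rmax + γ * C', fun s => ?_⟩⟩, fun s => ⟨?_, ?_⟩⟩
      · rw [funext (hVstar d hdD)]
        exact Measurable.iSup fun a => (hRmeas a).add
          ((measurable_integral_of_measurable_measure (hTmeas a) hm).const_mul γ)
      · rw [hVstar d hdD]
        exact abs_ciSup_le_of_forall_abs_le (hQ s)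
      · rw [hVhat d hdD]
        have := (hA' s d).to_subtype
        exact abs_ciSup_le_of_forall_abs_le fun a : A' s d => hQ' s a
      · rw [hVstar d hdD, hVhat d hdD, sub_nonneg]
        have := (hA' s d).to_subtype
        refine ciSup_le fun a => le_trans ?_
          (le_ciSup (bddAbove_range_of_forall_abs_le (hQ s)) (a : A))
        have := integral_mono (hi' s a) (hi s a) fun x => sub_nonneg.1 (hdiff x).1
        gcongr
      · have hstep : Vstar d s ≤ (⨆ a : A, (R s a + γ * ∫ x, Vhat (d + 1) x ∂(T s a))) +
            γ * (ρ * (1 - γ ^ k) / (1 - γ)) := by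
          rw [hVstar d hdD]
          refine ciSup_le fun a => ?_
          have hsup := le_ciSup (bddAbove_range_of_forall_abs_le (hQ' s)) a
          have hint : ∫ x, Vstar (d + 1) x ∂(T s a) ≤
              (∫ x, Vhat (d + 1) x ∂(T s a)) + ρ * (1 - γ ^ k) / (1 - γ) := by
            have h := integral_mono (hi s a)
              ((hi' s a).add (integrable_const (ρ * (1 - γ ^ k) / (1 - γ))))
              fun x => by
                have := (hdiff x).2
                simp only [Pi.add_apply]
                linarith
            simpa [integral_add (hi' s a) (integrable_const _)] using h
          have := mul_le_mul_of_nonneg_left hint hγ0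
          linarith
        have hreg := hregret s d hdD
        rw [← hVhat d hdD s] at hreg
        have hgeom : ρ * (1 - γ ^ (k + 1)) / (1 - γ) =
            ρ + γ * (ρ * (1 - γ ^ k) / (1 - γ)) := by
          field_simp
          ring
        linarith
  intro d hd s
  obtain ⟨h0, h1⟩ := (key (D - d) d (by omega)).2 s
  refine ⟨h0, h1, ?_⟩
  have := pow_nonneg hγ0 (D - d)
  gcongr
  nlinarith
end

section
/- Consider a finite-horizon discounted MDP skeleton (S, A, T, R, R_max, γ) with horizon D and restricted value functions V̂_d defined from nonempty subsets A'(s,d) ⊆ A. Fix, for each 0 ≤ d < D and (s,a) ∈ S × A, finitely many sample states s_{d,s,a,1}, …, s_{d,s,a,C} ∈ S and weights w_{d,s,a,1}, …, w_{d,s,a,C} ≥ 0 with Σᵢ w_{d,s,a,i} > 0, and write M_d(s,a)(f) = ( Σᵢ w_{d,s,a,i} f(s_{d,s,a,i}) ) / ( Σᵢ w_{d,s,a,i} ). Also fix estimated reward functions ρ_d : S × A → ℝ, and define the weighted sample-based estimates by W_D = 0 and W_d(s) = ⨆_{a∈A'(s,d)} ( ρ_d(s,a) + γ·M_d(s,a)(W_{d+1})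 ) for d < D. Suppose there is ε ≥ 0 such that |ρ_d(s,a) − R(s,a)| ≤ ε and |M_d(s,a)(V̂_{d+1}) − ∫_S V̂_{d+1} dT(s,a)| ≤ ε for all 0 ≤ d < D and all (s,a). Then for every 0 ≤ d ≤ D and every s ∈ S, |V̂_d(s) − W_d(s)| ≤ (1+γ)·ε·(1 − γ^{D−d})/(1 − γ) ≤ (1+γ)·ε/(1 − γ). (This is the deterministic skeleton of the 'POWSS bound' step in the VOWSS Intermediate Inequality: the reward-estimation error and the value-concentration error propagate through the recursion α(d) = (1+γ)ε + γ·α(d+1), α(D) = 0.) -/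
open MeasureTheory

/-- Conditionally complete suprema of uniformly close real families are close; no boundedness is
needed, since both suprema are `0` when the families are unbounded. -/
theorem abs_ciSup_sub_ciSup_le {ι : Type*} [Nonempty ι] {f g : ι → ℝ} {c : ℝ}
    (h : ∀ i, |f i - g i| ≤ c) : |(⨆ i, f i) - ⨆ i, g i| ≤ c := by
  have bdd_of_bdd : ∀ {u v : ι → ℝ}, (∀ i, |u i - v i| ≤ c) →
      BddAbove (Set.range u) → BddAbove (Set.range v) := by
    rintro u v huv ⟨b, hb⟩
    refine ⟨b + c, ?_⟩
    rintro _ ⟨i, rfl⟩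
    have h₁ := hb ⟨i, rfl⟩
    have h₂ := abs_le.1 (huv i)
    linarith
  have h' : ∀ i, |g i - f i| ≤ c := fun i => abs_sub_comm (f i) (g i) ▸ h i
  by_cases hf : BddAbove (Set.range f)
  · have hg := bdd_of_bdd h hf
    have hfg : (⨆ i, f i) ≤ (⨆ i, g i) + c := ciSup_le fun i => by
      have h₁ := le_ciSup hg i
      have h₂ := abs_le.1 (h i)
      linarith
    have hgf : (⨆ i, g i) ≤ (⨆ i, f i) + c := ciSup_le fun i => by
      have h₁ := le_ciSup hf i
      have h₂ := abs_le.1 (h i)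
      linarith
    exact abs_le.2 ⟨by linarith, by linarith⟩
  · have hg : ¬BddAbove (Set.range g) := fun hg => hf (bdd_of_bdd h' hg)
    rw [Real.iSup_of_not_bddAbove hf, Real.iSup_of_not_bddAbove hg, sub_zero, abs_zero]
    exact (abs_nonneg _).trans (h (Classical.arbitrary ι))

/-- Normalized weighted averages of uniformly close families are close. -/
theorem abs_weighted_average_sub_le {ι : Type*} [Fintype ι] {w f g : ι → ℝ} {c : ℝ}
    (hw : ∀ i, 0 ≤ w i) (hsum : 0 < ∑ i, w i) (h : ∀ i, |f i - g i| ≤ c) :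
    |(∑ i, w i * f i) / (∑ i, w i) - (∑ i, w i * g i) / (∑ i, w i)| ≤ c := by
  rw [← sub_div, ← Finset.sum_sub_distrib, abs_div, abs_of_pos hsum, div_le_iff₀ hsum,
    Finset.mul_sum]
  refine (Finset.abs_sum_le_sum_abs _ _).trans (Finset.sum_le_sum fun i _ => ?_)
  rw [← mul_sub, abs_mul, abs_of_nonneg (hw i), mul_comm c]
  exact mul_le_mul_of_nonneg_left (h i) (hw i)

/-- "POWSS bound" step (deterministic skeleton): if the estimated rewards `ρ_d` are within `ε`
of the true rewards and the normalized weighted averages `M_d(s,a)` approximate the integrals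
`∫ V̂_{d+1} dT(s,a)` within `ε` at every node, then the weighted sample-based estimates `W_d`
satisfy `|V̂_d(s) − W_d(s)| ≤ (1+γ)·ε·(1 − γ^(D−d))/(1 − γ) ≤ (1+γ)·ε/(1 − γ)`. -/
theorem powss_error_propagation
    {S : Type*} [MeasurableSpace S]
    {A : Type*} [Countable A] [Nonempty A]
    (T : S → A → Measure S) (hT : ∀ s a, IsProbabilityMeasure (T s a))
    (hTmeas : ∀ a : A, Measurable fun s => T s a)
    (R : S → A → ℝ) (hRmeas : ∀ a : A, Measurable fun s => R s a)
    (Rmax : ℝ) (hRmax : 0 ≤ Rmax) (hR : ∀ s a, |R s a| ≤ Rmax)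
    (γ : ℝ) (hγ0 : 0 ≤ γ) (hγ1 : γ < 1)
    (D : ℕ)
    (A' : S → ℕ → Set A) (hA' : ∀ s d, (A' s d).Nonempty)
    (Vhat : ℕ → S → ℝ)
    (hVhatD : ∀ s, Vhat D s = 0)
    (hVhat : ∀ d, d < D → ∀ s,
      Vhat d s = ⨆ a : A' s d, (R s ↑a + γ * ∫ x, Vhat (d + 1) x ∂(T s ↑a)))
    -- sample states and nonnegative weights of positive sum at every node
    (C : ℕ) (σ : ℕ → S → A → Fin C → S) (w : ℕ → S → A → Fin C → ℝ)
    (hw : ∀ d s a i, 0 ≤ w d s a i)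
    (hwsum : ∀ d s a, 0 < ∑ i, w d s a i)
    -- the normalized finitely-supported weighted average
    (M : ℕ → S → A → (S → ℝ) → ℝ)
    (hM : ∀ d s a f, M d s a f = (∑ i, w d s a i * f (σ d s a i)) / (∑ i, w d s a i))
    -- estimated reward functions
    (ρd : ℕ → S → A → ℝ)
    -- weighted sample-based estimates
    (W : ℕ → S → ℝ)
    (hWD : ∀ s, W D s = 0)
    (hW : ∀ d, d < D → ∀ s,
      W d s = ⨆ a : A' s d, (ρd d s ↑a + γ * M d s ↑a (W (d + 1))))
    -- per-node estimation errors
    (ε : ℝ) (hε : 0 ≤ ε)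
    (hρ : ∀ d, d < D → ∀ s a, |ρd d s a - R s a| ≤ ε)
    (hconc : ∀ d, d < D → ∀ s a,
      |M d s a (Vhat (d + 1)) - ∫ x, Vhat (d + 1) x ∂(T s a)| ≤ ε) :
    ∀ d ≤ D, ∀ s,
      |Vhat d s - W d s| ≤ (1 + γ) * ε * (1 - γ ^ (D - d)) / (1 - γ) ∧
      (1 + γ) * ε * (1 - γ ^ (D - d)) / (1 - γ) ≤ (1 + γ) * ε / (1 - γ) := by
  have hγ : 0 < 1 - γ := sub_pos.2 hγ1
  intro d hd s
  refine ⟨?_, ?_⟩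
  · induction hd using Nat.decreasingInduction generalizing s with
    | self => simp [hVhatD, hWD]
    | of_succ d hd ih =>
      have : Nonempty (A' s d) := (hA' s d).to_subtype
      rw [hVhat d hd s, hW d hd s]
      refine abs_ciSup_sub_ciSup_le fun a => ?_
      have hM' := abs_weighted_average_sub_le (hw d s a) (hwsum d s a)
        fun i => ih (σ d s a i)
      rw [← hM, ← hM] at hM'
      have hstep : (1 + γ) * ε * (1 - γ ^ (D - d)) / (1 - γ) =
          ε + γ * (ε + (1 + γ) * ε * (1 - γ ^ (D - (d + 1))) / (1 - γ)) := by
        rw [show D - d = D - (d + 1) + 1 by omega, pow_succ]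
        field_simp
        ring
      have hr := abs_le.1 (hρ d hd s a)
      have hc := abs_le.1 (hconc d hd s a)
      have hM'' := abs_le.1 hM'
      rw [hstep]
      have upper := mul_le_mul_of_nonneg_left (add_le_add hM''.2 (neg_le.1 hc.1)) hγ0
      have lower := mul_le_mul_of_nonneg_left (add_le_add hM''.1 (neg_le_neg hc.2)) hγ0
      exact abs_le.2 ⟨by linarith, by linarith⟩
  · refine div_le_div_of_nonneg_right (mul_le_of_le_one_right (by positivity) ?_) hγ.le
    exact sub_le_self _ (pow_nonneg hγ0 _)
end
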